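/- The series ∑_{n=0}^∞ ((1/2)_n (1/4)_n (3/4)_n)/((1)_n^3) · (32/81)^n equals √3·π / (2·Γ(7/12)²·Γ(11/12)²). -/

import Mathlib

open Real

noncomputable def poch (a : ℝ) (n : ℕ) : ℝ := (ascPochhammer ℝ n).eval a

lemma poch_zero' (a : ℝ) : poch a 0 = 1 := by simp [poch]

lemma poch_succ' (a : ℝ) (n : ℕ) : poch a (n+1) = poch a n * (a + n) := by
  simp [poch, ascPochhammer_succ_eval]

lemma poch_pos' (a : ℝ) (ha : 0 < a) (n : ℕ) : 0 < poch a n := by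
  induction n with
  | zero => simp [poch_zero']
  | succ n ih => rw [poch_succ']; positivity

/-- Coefficients of the Gauss hypergeometric series with third parameter one. -/
noncomputable def hc (a b : ℝ) (n : ℕ) : ℝ := poch a n * poch b n / (poch 1 n)^2

lemma hc_zero (a b : ℝ) : hc a b 0 = 1 := by simp [hc, poch_zero']

lemma hc_succ (a b : ℝ) (n : ℕ) :
    ((n:ℝ)+1)^2 * hc a b (n+1) = (n+a)*(n+b) * hc a b n := by
  have h1 := poch_pos' 1 one_pos n
  have h2 : (0:ℝ) < 1 + n := by positivity
  simp only [hc, poch_succ']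
  field_simp
  ring

lemma hc_nonneg (a b : ℝ) (ha : 0 < a) (hb : 0 < b) (n : ℕ) : 0 ≤ hc a b n := by
  have h1 := poch_pos' 1 one_pos n
  have h2 := poch_pos' a ha n
  have h3 := poch_pos' b hb n
  unfold hc
  positivity

lemma hc_le (a b : ℝ) (ha : 0 < a) (hb : 0 < b) (ha' : a ≤ 1) (hb' : b ≤ 1) (n : ℕ) :
    hc a b n ≤ 1 := by
  induction n with
  | zero => simp [hc_zero]
  | succ n ih =>
    have h := hc_succ a b n
    have h0 := hc_nonneg a b ha hb n
    have hp : (0:ℝ) < ((n:ℝ)+1)^2 := by positivity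
    have h3 : ((n:ℝ)+a)*(n+b) ≤ ((n:ℝ)+1)^2 := by
      rw [sq]; gcongr
    have h4 : ((n:ℝ)+a)*(n+b) * hc a b n ≤ ((n:ℝ)+1)^2 * 1 :=
      mul_le_mul h3 ih h0 hp.le
    rw [← h] at h4
    exact le_of_mul_le_mul_left h4 hp

/-- Polynomially bounded sequences. -/
def PB (c : ℕ → ℝ) : Prop := ∃ (C : ℝ) (k : ℕ), ∀ n, |c n| ≤ C * ((n:ℝ)+1)^k

/-- derivative sequence -/
def dseq (c : ℕ → ℝ) (n : ℕ) : ℝ := ((n:ℝ)+1) * c (n+1)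

/-- sum of the power series -/
noncomputable def ps (c : ℕ → ℝ) (x : ℝ) : ℝ := ∑' n, c n * x^n

lemma PB.dseq {c : ℕ → ℝ} (h : PB c) : PB (dseq c) := by
  obtain ⟨C, k, h⟩ := h
  have hC : 0 ≤ C := by
    have := h 0
    simp at this
    exact (abs_nonneg _).trans this
  refine ⟨C * 2^k, k+1, fun n => ?_⟩
  have h1 := h (n+1)
  have hn : (0:ℝ) ≤ n := by positivity
  unfold _root_.dseq
  rw [abs_mul, abs_of_nonneg (by positivity : (0:ℝ) ≤ (n:ℝ)+1)]
  calc ((n:ℝ)+1) * |c (n+1)| ≤ ((n:ℝ)+1) * (C * (((n+1:ℕ):ℝ)+1)^k) := by gcongr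
    _ ≤ ((n:ℝ)+1) * (C * (2*((n:ℝ)+1))^k) := by
        gcongr; push_cast; linarith
    _ = _ := by rw [mul_pow]; ring

lemma summable_aux (k : ℕ) {r : ℝ} (h0 : 0 ≤ r) (hr : r < 1) :
    Summable (fun n : ℕ => ((n:ℝ)+1)^k * r^n) := by
  rcases h0.eq_or_lt with rfl | h0
  · refine summable_of_ne_finset_zero (s := {0}) ?_
    intro n hn
    have : n ≠ 0 := by simpa using hn
    simp [this]
  have h := summable_pow_mul_geometric_of_norm_lt_one k (r := r) (by rwa [norm_of_nonneg h0.le])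
  have h2 := ((summable_nat_add_iff 1).2 h).mul_left (r⁻¹)
  refine h2.congr fun n => ?_
  push_cast
  rw [pow_succ]; field_simp

lemma PB.summable {c : ℕ → ℝ} (h : PB c) {x : ℝ} (hx : |x| < 1) :
    Summable (fun n => |c n * x^n|) := by
  obtain ⟨C, k, h⟩ := h
  refine Summable.of_nonneg_of_le (fun n => abs_nonneg _) (fun n => ?_)
    ((summable_aux k (abs_nonneg x) hx).mul_left C)
  rw [abs_mul, abs_pow, ← mul_assoc]
  gcongr
  exact h n

lemma PB.summable' {c : ℕ → ℝ} (h : PB c) {x : ℝ} (hx : |x| < 1) :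
    Summable (fun n => c n * x^n) := (h.summable hx).of_abs

lemma PB.mul_nat {c : ℕ → ℝ} (h : PB c) : PB (fun n => (n:ℝ) * c n) := by
  obtain ⟨C, k, h⟩ := h
  refine ⟨C, k+1, fun n => ?_⟩
  have h1 := h n
  have hC : 0 ≤ C * ((n:ℝ)+1)^k := (abs_nonneg _).trans h1
  have hn : (0:ℝ) ≤ n := by positivity
  rw [abs_mul, abs_of_nonneg hn]
  calc (n:ℝ) * |c n| ≤ ((n:ℝ)+1) * (C * ((n:ℝ)+1)^k) := by
        apply mul_le_mul _ h1 (abs_nonneg _) (by positivity); linarith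
    _ = _ := by ring

lemma mul_ps_dseq {c : ℕ → ℝ} (h : PB c) {x : ℝ} (hx : |x| < 1) :
    x * ps (dseq c) x = ps (fun n => (n:ℝ) * c n) x := by
  unfold ps
  rw [(h.mul_nat.summable' hx).tsum_eq_zero_add, ← tsum_mul_left]
  simp only [Nat.cast_zero, zero_mul, zero_add]
  congr 1; ext n
  simp only [dseq]; push_cast; ring

lemma ps_hasDerivAt {c : ℕ → ℝ} (h : PB c) {x : ℝ} (hx : |x| < 1) :
    HasDerivAt (ps c) (ps (dseq c) x) x := by
  obtain ⟨r, hxr, hr1⟩ := exists_between hx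
  have hr0 : 0 ≤ r := (abs_nonneg x).trans hxr.le
  have hd := h.dseq.summable (x := r) (by rwa [abs_of_nonneg hr0])
  have key : HasDerivAt (fun z => ∑' n, c (n+1) * z^(n+1)) (∑' n, dseq c n * x^n) x := by
    refine hasDerivAt_tsum_of_isPreconnected (g := fun n z => c (n+1) * z^(n+1))
      (g' := fun n z => dseq c n * z^n) (t := Metric.ball (0:ℝ) r) (y₀ := 0) hd Metric.isOpen_ball
      (convex_ball _ _).isPreconnected ?_ ?_ ?_ ?_ ?_
    · intro n y _
      have := (hasDerivAt_pow (n+1) y).const_mul (c (n+1))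
      refine this.congr_deriv ?_
      simp only [dseq]; push_cast; ring
    · intro n y hy
      rw [Real.norm_eq_abs, abs_mul, abs_mul]
      have hy' : |y| < r := by simpa using hy
      rw [abs_pow, abs_pow, abs_of_nonneg hr0]
      gcongr
    · simpa using (lt_of_le_of_lt (abs_nonneg x) hxr)
    · simp [summable_zero]
    · simpa using hxr
  have h2 := key.const_add (c 0)
  refine h2.congr_of_eventuallyEq ?_
  have : Metric.ball (0:ℝ) 1 ∈ nhds x := Metric.isOpen_ball.mem_nhds (by simpa using hx)
  filter_upwards [this] with z hz
  have hz' : |z| < 1 := by simpa using hz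
  unfold ps
  rw [(h.summable' hz').tsum_eq_zero_add]
  simp

lemma hc_PB {a b : ℝ} (ha : 0 < a) (hb : 0 < b) (ha' : a ≤ 1) (hb' : b ≤ 1) : PB (hc a b) :=
  ⟨1, 0, fun n => by
    rw [abs_of_nonneg (hc_nonneg a b ha hb n)]; simpa using hc_le a b ha hb ha' hb' n⟩

lemma hc_ode {a b : ℝ} (ha : 0 < a) (hb : 0 < b) (ha' : a ≤ 1) (hb' : b ≤ 1) {x : ℝ}
    (hx : |x| < 1) :
    x*(1-x) * ps (dseq (dseq (hc a b))) x + (1 - (a+b+1)*x) * ps (dseq (hc a b)) x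
      = a*b*ps (hc a b) x := by
  have h0 := hc_PB ha hb ha' hb'
  have e1 := mul_ps_dseq h0 hx
  have e2 := mul_ps_dseq h0.dseq hx
  have e3 := mul_ps_dseq h0.mul_nat hx
  -- the sequence n ↦ n(n+1)u(n+1)
  have hs : ∀ n, dseq (fun n => (n:ℝ) * hc a b n) n
      = (n:ℝ) * dseq (hc a b) n + dseq (hc a b) n := by
    intro n; simp only [dseq]; push_cast; ring
  have e4 : ps (dseq (fun n => (n:ℝ) * hc a b n)) x
      = ps (fun n => (n:ℝ) * dseq (hc a b) n) x + ps (dseq (hc a b)) x := by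
    unfold ps
    rw [← (h0.dseq.mul_nat.summable' hx).tsum_add (h0.dseq.summable' hx)]
    congr 1; ext n; rw [hs]; ring
  have e5 : ps (dseq (fun n => (n:ℝ) * hc a b n)) x
      = ps (fun n => (n:ℝ) * ((n:ℝ) * hc a b n)) x + (a+b) * ps (fun n => (n:ℝ) * hc a b n) x
        + a*b*ps (hc a b) x := by
    unfold ps
    rw [← tsum_mul_left, ← tsum_mul_left, ← (h0.mul_nat.mul_nat.summable' hx).tsum_add
      ((h0.mul_nat.summable' hx).mul_left _), ← ((h0.mul_nat.mul_nat.summable' hx).add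
      ((h0.mul_nat.summable' hx).mul_left _)).tsum_add ((h0.summable' hx).mul_left _)]
    congr 1; ext n
    have := hc_succ a b n
    simp only [dseq]; push_cast
    linear_combination x^n * this
  linear_combination e5 + (1-x) * e2 - (a+b) * e1 - (1-x) * e4 - e3

lemma ps_hc_pos {a b : ℝ} (ha : 0 < a) (hb : 0 < b) (ha' : a ≤ 1) (hb' : b ≤ 1) {x : ℝ}
    (h0 : 0 ≤ x) (hx : x < 1) : 0 < ps (hc a b) x := by
  have hs := (hc_PB ha hb ha' hb').summable' (x := x) (by rwa [abs_of_nonneg h0])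
  unfold ps
  refine hs.tsum_pos (fun n => mul_nonneg (hc_nonneg a b ha hb n) (by positivity)) 0 ?_
  simp [hc_zero]

lemma ps_hc_zero (a b : ℝ) : ps (hc a b) 0 = 1 := by
  unfold ps
  rw [tsum_eq_single 0]
  · simp [hc_zero]
  · intro n hn; simp [hn]

/-- Quadratic transformation on `[0, 1/9]`. -/
lemma quad_transf {x : ℝ} (hx : x ∈ Set.Icc (0:ℝ) (1/9)) :
    ps (hc (1/8) (3/8)) (4*x*(1-x)) = ps (hc (1/4) (3/4)) x := by
  have hF := hc_PB (a := 1/4) (b := 3/4) (by norm_num) (by norm_num) (by norm_num) (by norm_num)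
  have hK := hc_PB (a := 1/8) (b := 3/8) (by norm_num) (by norm_num) (by norm_num) (by norm_num)
  set F := ps (hc (1/4) (3/4)) with hFdef
  set F1 := ps (dseq (hc (1/4) (3/4))) with hF1def
  set F2 := ps (dseq (dseq (hc (1/4) (3/4)))) with hF2def
  set K := ps (hc (1/8) (3/8)) with hKdef
  set K1 := ps (dseq (hc (1/8) (3/8))) with hK1def
  set K2 := ps (dseq (dseq (hc (1/8) (3/8)))) with hK2def
  have b1 : ∀ y ∈ Set.Icc (0:ℝ) (1/9), |y| < 1 := by
    rintro y ⟨h1, h2⟩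
    rw [abs_of_nonneg h1]; linarith
  have b2 : ∀ y ∈ Set.Icc (0:ℝ) (1/9), |4*y*(1-y)| < 1 := by
    rintro y ⟨h1, h2⟩
    rw [abs_lt]; constructor <;> nlinarith
  have dw : ∀ y : ℝ, HasDerivAt (fun y : ℝ => 4*y*(1-y)) (4*(1-2*y)) y := by
    intro y
    have h1 := ((hasDerivAt_id y).const_mul 4).mul ((hasDerivAt_id y).const_sub 1)
    refine h1.congr_deriv ?_
    simp; ring
  have dw1 : ∀ y : ℝ, HasDerivAt (fun y : ℝ => 4*(1-2*y)) (-8) y := by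
    intro y
    have h1 := (((hasDerivAt_id y).const_mul 2).const_sub 1).const_mul 4
    refine h1.congr_deriv ?_
    norm_num
  have dF : ∀ y ∈ Set.Icc (0:ℝ) (1/9), HasDerivAt F (F1 y) y := fun y hy =>
    ps_hasDerivAt hF (b1 y hy)
  have dF1 : ∀ y ∈ Set.Icc (0:ℝ) (1/9), HasDerivAt F1 (F2 y) y := fun y hy =>
    ps_hasDerivAt hF.dseq (b1 y hy)
  have dk : ∀ y ∈ Set.Icc (0:ℝ) (1/9), HasDerivAt (fun y => K (4*y*(1-y)))
      (K1 (4*y*(1-y)) * (4*(1-2*y))) y := fun y hy =>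
    by have h := (ps_hasDerivAt hK (b2 y hy)).comp y (dw y); exact h
  have dk1 : ∀ y ∈ Set.Icc (0:ℝ) (1/9), HasDerivAt (fun y => K1 (4*y*(1-y)) * (4*(1-2*y)))
      (K2 (4*y*(1-y)) * (4*(1-2*y)) * (4*(1-2*y)) + K1 (4*y*(1-y)) * (-8)) y := fun y hy =>
    by have h := ((ps_hasDerivAt hK.dseq (b2 y hy)).comp y (dw y)).mul (dw1 y); exact h
  have oF : ∀ y ∈ Set.Icc (0:ℝ) (1/9), _ := fun y hy => hc_ode (a := 1/4) (b := 3/4)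
    (by norm_num) (by norm_num) (by norm_num) (by norm_num) (b1 y hy)
  have oK : ∀ y ∈ Set.Icc (0:ℝ) (1/9), _ := fun y hy => hc_ode (a := 1/8) (b := 3/8)
    (by norm_num) (by norm_num) (by norm_num) (by norm_num) (b2 y hy)
  rw [← hFdef, ← hF1def, ← hF2def] at oF
  rw [← hKdef, ← hK1def, ← hK2def] at oK
  have dp : ∀ y : ℝ, HasDerivAt (fun y : ℝ => y*(1-y)) (1-2*y) y := by
    intro y
    have h1 := (hasDerivAt_id y).mul ((hasDerivAt_id y).const_sub 1)
    refine h1.congr_deriv ?_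
    simp; ring
  -- the Wronskian
  have dW : ∀ y ∈ Set.Icc (0:ℝ) (1/9), HasDerivAt (fun y => (y*(1-y)) *
      (F y * (K1 (4*y*(1-y)) * (4*(1-2*y))) - F1 y * K (4*y*(1-y)))) 0 y := by
    intro y hy
    refine ((dp y).mul (((dF y hy).mul (dk1 y hy)).sub ((dF1 y hy).mul (dk y hy)))).congr_deriv ?_
    have h1 := oF y hy
    have h2 := oK y hy
    simp only [Pi.mul_apply, Pi.sub_apply]
    linear_combination 4 * F y * h2 - K (4*y*(1-y)) * h1
  have hW0 : ∀ y ∈ Set.Icc (0:ℝ) (1/9), (y*(1-y)) *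
      (F y * (K1 (4*y*(1-y)) * (4*(1-2*y))) - F1 y * K (4*y*(1-y))) = 0 := by
    intro y hy
    have := constant_of_has_deriv_right_zero (fun z hz => (dW z hz).continuousAt.continuousWithinAt)
      (fun z hz => (dW z ⟨hz.1, hz.2.le⟩).hasDerivWithinAt) y hy
    simpa using this
  have hW : ∀ y ∈ Set.Icc (0:ℝ) (1/9),
      F y * (K1 (4*y*(1-y)) * (4*(1-2*y))) - F1 y * K (4*y*(1-y)) = 0 := by
    intro y hy
    rcases hy.1.eq_or_lt with h | h
    · have h1 := oF y hy
      have h2 := oK y hy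
      rw [← h] at h1 h2 ⊢
      norm_num at h1 h2 ⊢
      rw [h1, h2]; ring
    · have := hW0 y hy
      rcases mul_eq_zero.1 this with h' | h'
      · exfalso
        have : 0 < y * (1-y) := mul_pos h (by linarith [hy.2])
        exact this.ne' h'
      · exact h'
  have Fpos : ∀ y ∈ Set.Icc (0:ℝ) (1/9), 0 < F y := fun y hy =>
    ps_hc_pos (by norm_num) (by norm_num) (by norm_num) (by norm_num) hy.1 (by linarith [hy.2])
  have dR : ∀ y ∈ Set.Icc (0:ℝ) (1/9), HasDerivAt (fun y => K (4*y*(1-y)) / F y) 0 y := by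
    intro y hy
    refine ((dk y hy).div (dF y hy) (Fpos y hy).ne').congr_deriv ?_
    have h1 := hW y hy
    rw [div_eq_zero_iff]
    left
    linear_combination h1
  have := constant_of_has_deriv_right_zero (fun z hz => (dR z hz).continuousAt.continuousWithinAt)
      (fun z hz => (dR z ⟨hz.1, hz.2.le⟩).hasDerivWithinAt) x hx
  have hF0 : F 0 = 1 := ps_hc_zero _ _
  have hK0 : K 0 = 1 := ps_hc_zero _ _
  simp only [mul_zero, zero_mul, hF0, hK0, div_one] at this
  rwa [div_eq_one_iff_eq (Fpos x hx).ne'] at this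

section Clausen
open PowerSeries

/-- The Euler operator on power series. -/
noncomputable def th (f : PowerSeries ℝ) : PowerSeries ℝ := X * PowerSeries.derivative ℝ f

lemma coeff_th (f : PowerSeries ℝ) (n : ℕ) : coeff n (th f) = n * coeff n f := by
  unfold th
  cases n with
  | zero => simp
  | succ n => rw [coeff_succ_X_mul, coeff_derivative]; push_cast; ring

lemma th_mul (f g : PowerSeries ℝ) : th (f * g) = f * th g + g * th f := by
  unfold th
  rw [Derivation.leibniz]; simp only [smul_eq_mul]; ring

lemma th_add (f g : PowerSeries ℝ) : th (f + g) = th f + th g := by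
  unfold th
  rw [map_add]; ring

lemma th_X : th (X : PowerSeries ℝ) = X := by
  unfold th; simp

lemma coeff_nat_mul' (k : ℕ) (f : PowerSeries ℝ) (n : ℕ) :
    coeff n ((k : PowerSeries ℝ) * f) = k * coeff n f := by
  rw [← map_natCast (PowerSeries.C (R := ℝ)) k, coeff_C_mul]

lemma th_nat_mul (k : ℕ) (f : PowerSeries ℝ) :
    th ((k : PowerSeries ℝ) * f) = (k : PowerSeries ℝ) * th f := by
  ext n; rw [coeff_th, coeff_nat_mul', coeff_nat_mul', coeff_th]; ring

lemma clausen (n : ℕ) : ∑ p ∈ Finset.HasAntidiagonal.antidiagonal n, hc (1/8) (3/8) p.1 * hc (1/8) (3/8) p.2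
    = poch (1/2) n * poch (1/4) n * poch (3/4) n / (poch 1 n)^3 := by
  set V : PowerSeries ℝ := PowerSeries.mk (hc (1/8) (3/8)) with hV
  have e : ((64:ℕ) : PowerSeries ℝ) * th (th V) = X * (((64:ℕ) : PowerSeries ℝ) * th (th V) +
      ((32:ℕ) : PowerSeries ℝ) * th V + ((3:ℕ) : PowerSeries ℝ) * V) := by
    ext n
    cases n with
    | zero => rw [coeff_nat_mul']; simp [coeff_th]
    | succ n =>
      rw [coeff_succ_X_mul]
      simp only [map_add, coeff_nat_mul', coeff_th, hV, coeff_mk]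
      have := hc_succ (1/8) (3/8) n
      push_cast
      linear_combination 64 * this
  have e' := congrArg th e
  rw [th_nat_mul, th_mul, th_X, th_add, th_add, th_nat_mul, th_nat_mul, th_nat_mul] at e'
  have g1 : th (V*V) = ((2:ℕ) : PowerSeries ℝ) * (V * th V) := by
    rw [th_mul]; push_cast; ring
  have g2 : th (th (V*V)) = ((2:ℕ) : PowerSeries ℝ) * (V * th (th V) + th V * th V) := by
    rw [g1, th_nat_mul, th_mul]
  have g3 : th (th (th (V*V))) = ((2:ℕ) : PowerSeries ℝ) *
      (V * th (th (th V)) + ((3:ℕ) : PowerSeries ℝ) * (th V * th (th V))) := by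
    rw [g2, th_nat_mul, th_add, th_mul, th_mul]; push_cast; ring
  have e3 : ((32:ℕ) : PowerSeries ℝ) * th (th (th (V*V))) =
      X * (((32:ℕ) : PowerSeries ℝ) * th (th (th (V*V))) + ((48:ℕ) : PowerSeries ℝ) * th (th (V*V))
        + ((22:ℕ) : PowerSeries ℝ) * th (V*V) + ((3:ℕ) : PowerSeries ℝ) * (V*V)) := by
    rw [g3, g2, g1]
    push_cast at e e' ⊢
    linear_combination V * e' + 3 * th V * e
  have hsum : ∀ n, coeff n (V*V) = ∑ p ∈ Finset.HasAntidiagonal.antidiagonal n,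
      hc (1/8) (3/8) p.1 * hc (1/8) (3/8) p.2 := by
    intro n; rw [coeff_mul]; simp [hV]
  rw [← hsum]
  induction n with
  | zero => rw [hsum]; simp [hc_zero, poch_zero']
  | succ n ih =>
    have h := congrArg (coeff (n+1)) e3
    rw [coeff_succ_X_mul] at h
    simp only [map_add, coeff_nat_mul', coeff_th] at h
    rw [ih] at h
    have h1 := poch_pos' 1 one_pos n
    have h2 : (0:ℝ) < 1 + n := by positivity
    simp only [poch_succ']
    push_cast at h
    rw [eq_div_iff (by positivity)]
    have h3 : poch (1/2) n * poch (1/4) n * poch (3/4) n / (poch 1 n)^3 * (poch 1 n)^3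
      = poch (1/2) n * poch (1/4) n * poch (3/4) n := by field_simp
    linear_combination (poch 1 n)^3 * h / 32 + (n+1/4)*(n+1/2)*(n+3/4) * h3
end Clausen

lemma series_eq_sq : ∑' n : ℕ, (poch (1/2) n * poch (1/4) n * poch (3/4) n) / (poch 1 n)^3 * ((1:ℝ))
    * ((32:ℝ)/81)^n = (ps (hc (1/4) (3/4)) (1/9))^2 := by
  have h0 := quad_transf (x := 1/9) ⟨by norm_num, le_refl _⟩
  rw [show (4 * (1/9) * (1 - 1/9) : ℝ) = 32/81 by norm_num] at h0
  rw [← h0, sq]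
  have hK := hc_PB (a := 1/8) (b := 3/8) (by norm_num) (by norm_num) (by norm_num) (by norm_num)
  have hs : Summable (fun n => ‖hc (1/8) (3/8) n * (32/81:ℝ)^n‖) :=
    hK.summable (x := 32/81) (by rw [abs_of_pos] <;> norm_num)
  unfold ps
  rw [tsum_mul_tsum_eq_tsum_sum_antidiagonal_of_summable_norm hs hs]
  refine tsum_congr fun n => ?_
  have hc' := clausen n
  rw [← hc', mul_one, Finset.sum_mul]
  refine Finset.sum_congr rfl fun p hp => ?_
  have h1 : p.1 + p.2 = n := Finset.HasAntidiagonal.mem_antidiagonal.1 hp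
  rw [← h1, pow_add]; ring

section Triple
open Set

/-- Auxiliary function for the triplication formula. -/
noncomputable def tripGamma (s : ℝ) : ℝ :=
  Gamma (s/3) * Gamma (s/3+1/3) * Gamma (s/3+2/3) * 3^(s-1) / (Gamma (1/3) * Gamma (2/3))

lemma tripGamma_add_one (s : ℝ) (hs : s ≠ 0) : tripGamma (s+1) = s * tripGamma s := by
  unfold tripGamma
  rw [show (s+1)/3 = s/3+1/3 by ring, show s/3+1/3+1/3 = s/3+2/3 by ring,
    show s/3+1/3+2/3 = s/3+1 by ring, Gamma_add_one (div_ne_zero hs three_ne_zero),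
    show s+1-1 = s-1+1 by ring, rpow_add three_pos, rpow_one]
  ring

lemma tripGamma_one : tripGamma 1 = 1 := by
  unfold tripGamma
  have h1 : Gamma (1/3) ≠ 0 := (Gamma_pos_of_pos (by norm_num)).ne'
  have h2 : Gamma (2/3) ≠ 0 := (Gamma_pos_of_pos (by norm_num)).ne'
  rw [show (1:ℝ)/3+1/3 = 2/3 by norm_num, show (1:ℝ)/3+2/3 = 1 by norm_num, Gamma_one]
  simp only [sub_self, rpow_zero, mul_one]
  field_simp

lemma convex_aux (c : ℝ) (hc : 0 ≤ c) :
    ConvexOn ℝ (Ioi (0:ℝ)) (fun s => log (Gamma (s/3 + c))) := by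
  have h := convexOn_log_Gamma
  refine ⟨convex_Ioi _, ?_⟩
  intro x hx y hy a b ha hb hab
  have hx' : (0:ℝ) < x := hx
  have hy' : (0:ℝ) < y := hy
  have := h.2 (x := x/3+c) (y := y/3+c) (show (0:ℝ) < _ by positivity)
    (show (0:ℝ) < _ by positivity) ha hb hab
  simp only [smul_eq_mul, Function.comp_apply] at this ⊢
  convert this using 3
  linear_combination (-c) * hab

lemma tripGamma_convex : ConvexOn ℝ (Ioi (0:ℝ)) (log ∘ tripGamma) := by
  have hlin : ConvexOn ℝ (Ioi (0:ℝ)) (fun s : ℝ => log 3 * s) :=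
    (convexOn_id (convex_Ioi (0:ℝ))).smul (log_pos (by norm_num)).le
  refine (((((convex_aux 0 le_rfl).add (convex_aux (1/3) (by norm_num))).add
    (convex_aux (2/3) (by norm_num))).add hlin).add_const
    (- log 3 - log (Gamma (1/3) * Gamma (2/3)))).congr ?_
  intro s hs
  have hs' : (0:ℝ) < s := hs
  have h1 : Gamma (1/3) * Gamma (2/3) ≠ 0 :=
    (mul_pos (Gamma_pos_of_pos (by norm_num)) (Gamma_pos_of_pos (by norm_num))).ne'
  have h2 : Gamma (s/3) ≠ 0 := (Gamma_pos_of_pos (by positivity)).ne'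
  have h3 : Gamma (s/3+1/3) ≠ 0 := (Gamma_pos_of_pos (by positivity)).ne'
  have h4 : Gamma (s/3+2/3) ≠ 0 := (Gamma_pos_of_pos (by positivity)).ne'
  have h5 : (3:ℝ)^(s-1) ≠ 0 := (rpow_pos_of_pos three_pos _).ne'
  simp only [Pi.add_apply, Function.comp_apply, tripGamma, add_zero]
  rw [log_div (by positivity) h1, log_mul (by positivity) h5, log_mul (by positivity) h4,
    log_mul h2 h3, log_rpow three_pos]
  ring

lemma tripGamma_eq {s : ℝ} (hs : 0 < s) : tripGamma s = Gamma s := by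
  refine eq_Gamma_of_log_convex tripGamma_convex (fun {y} hy => tripGamma_add_one y hy.ne')
    (fun {y} hy => ?_) tripGamma_one hs
  have h1 : 0 < Gamma (1/3) * Gamma (2/3) :=
    (mul_pos (Gamma_pos_of_pos (by norm_num)) (Gamma_pos_of_pos (by norm_num)))
  have h2 : 0 < Gamma (y/3) := (Gamma_pos_of_pos (by positivity))
  have h3 : 0 < Gamma (y/3+1/3) := (Gamma_pos_of_pos (by positivity))
  have h4 : 0 < Gamma (y/3+2/3) := (Gamma_pos_of_pos (by positivity))
  have h5 : 0 < (3:ℝ)^(y-1) := (rpow_pos_of_pos three_pos _)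
  unfold tripGamma
  positivity

lemma gamma_quarter : Gamma (1/4) * Gamma (3/4) = π * √2 := by
  have := Gamma_mul_Gamma_one_sub (1/4)
  rw [show (1:ℝ) - 1/4 = 3/4 by norm_num, show π * (1/4) = π/4 by ring, sin_pi_div_four] at this
  rw [this]
  have h : √2 * √2 = 2 := mul_self_sqrt (by norm_num)
  have h0 : √2 ≠ 0 := by positivity
  field_simp
  linear_combination -h

lemma gamma_third : Gamma (1/3) * Gamma (2/3) = 2 * π / √3 := by
  have := Gamma_mul_Gamma_one_sub (1/3)
  rw [show (1:ℝ) - 1/3 = 2/3 by norm_num, show π * (1/3) = π/3 by ring, sin_pi_div_three] at this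
  rw [this]
  have h0 : √3 ≠ 0 := by positivity
  field_simp

lemma gamma_twelfths : (Gamma (7/12))^2 * (Gamma (11/12))^2 = 2 / √3 * Gamma (3/4)^4 := by
  have h := tripGamma_eq (s := 3/4) (by norm_num)
  unfold tripGamma at h
  rw [gamma_third] at h
  norm_num at h
  have h4 := gamma_quarter
  have hp : 0 < Gamma (3/4) := Gamma_pos_of_pos (by norm_num)
  have hq : 0 < Gamma (1/4) := Gamma_pos_of_pos (by norm_num)
  set A := Gamma (7/12)
  set B := Gamma (11/12)
  set G := Gamma (3/4)
  set Q := Gamma (1/4)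
  have hr : ((3:ℝ) ^ (-1/4:ℝ))^2 = 1/√3 := by
    rw [← rpow_natCast, ← rpow_mul (by norm_num), sqrt_eq_rpow, one_div, ← rpow_neg (by norm_num)]
    norm_num
  have h30 : (0:ℝ) < √3 := by positivity
  have h3 : √3^2 = 3 := sq_sqrt (by norm_num)
  have h2 : √2^2 = 2 := sq_sqrt (by norm_num)
  have hpi := pi_pos
  rw [show (-(1/4) : ℝ) = -1/4 by norm_num] at h
  set r := (3:ℝ) ^ (-1/4:ℝ)
  have h' : Q*A*B*r*√3 = 2*π*G := by
    rw [div_eq_iff (by positivity)] at h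
    rw [h]; field_simp
  have hr' : r^2 * √3 = 1 := by rw [hr]; field_simp
  have e1 : Q^2*A^2*B^2*√3 = 4*π^2*G^2 := by
    linear_combination (Q*A*B*r*√3 + 2*π*G) * h' - Q^2*A^2*B^2*√3 * hr'
  have e2 : Q^2*G^2 = 2*π^2 := by
    linear_combination (Q*G + π*√2) * h4 + π^2 * h2
  have e3 : (2*π^2) * (A^2*B^2*√3) = (2*π^2) * (2*G^4) := by
    linear_combination G^2 * e1 - A^2*B^2*√3 * e2
  have e4 := mul_left_cancel₀ (by positivity) e3
  field_simp
  linear_combination e4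
end Triple

lemma bin_hasSum {y : ℝ} (hy : |y| < 1) :
    HasSum (fun m => poch (1/2) m / poch 1 m * y^m) (1/(1-y)^(1/2:ℝ)) := by
  have h := (one_div_one_sub_rpow_hasFPowerSeriesOnBall_zero (1/2)).hasSum (y := y) (by
    simpa [enorm_eq_nnnorm] using! hy)
  simp only [zero_add] at h
  suffices hf : ∀ m, poch (1/2) m / poch 1 m * y^m = (FormalMultilinearSeries.ofScalars ℝ
      (fun n : ℕ => Ring.choose ((1/2:ℝ) + n - 1) n) m) (fun _ => y) by
    rw [funext hf]; exact h
  intro m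
  simp only [FormalMultilinearSeries.ofScalars_apply_eq, smul_eq_mul]
  congr 1
  have h1 : poch 1 m = m.factorial := by simp [poch, ascPochhammer_eval_one]
  have h2 : Ring.choose ((1/2:ℝ) + m - 1) m = Ring.multichoose (1/2:ℝ) m := by
    unfold Ring.choose; congr 1; ring
  have h3 := Ring.factorial_nsmul_multichoose_eq_ascPochhammer (1/2:ℝ) m
  rw [h1, h2, div_eq_iff (by positivity)]
  rw [nsmul_eq_mul] at h3
  rw [mul_comm, h3, poch, Polynomial.ascPochhammer_smeval_eq_eval]

/-- cosine power integrals -/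
noncomputable def J (m : ℕ) : ℝ := ∫ t in (0:ℝ)..π, cos t ^ m

lemma J_rec (m : ℕ) : ((m:ℝ)+2) * J (m+2) = (m+1) * J m := by
  unfold J
  rw [integral_cos_pow]
  simp
  field_simp

lemma J_odd (n : ℕ) : J (2*n+1) = 0 := by
  induction n with
  | zero => simp [J]
  | succ n ih =>
    have h := J_rec (2*n+1)
    rw [ih, mul_zero] at h
    have : ((2*n+1:ℕ):ℝ)+2 ≠ 0 := by positivity
    exact (mul_eq_zero.1 h).resolve_left this

lemma bJ_even (n : ℕ) : poch (1/2) (2*n) / poch 1 (2*n) * J (2*n) = π * hc (1/4) (3/4) n := by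
  induction n with
  | zero => simp [J, hc_zero, poch_zero']
  | succ n ih =>
    have h := J_rec (2*n)
    have h2 := hc_succ (1/4) (3/4) n
    rw [show 2*(n+1) = 2*n+1+1 by ring]
    simp only [poch_succ']
    have p1 := poch_pos' 1 one_pos (2*n)
    push_cast at h ⊢
    have a1 : (0:ℝ) < 1 + 2*n := by positivity
    have a2 : (0:ℝ) < 1 + (2*n+1) := by positivity
    have hn : (0:ℝ) < (n:ℝ)+1 := by positivity
    have hJ : J (2*n+1+1) = (2*n+1) * J (2*n) / (2*n+2) := by
      rw [eq_div_iff (by positivity)]; linear_combination h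
    have hh : hc (1/4) (3/4) (n+1) = (n+1/4)*(n+3/4) * hc (1/4) (3/4) n / ((n:ℝ)+1)^2 := by
      rw [eq_div_iff (by positivity)]; linear_combination h2
    have : π * hc (1/4) (3/4) (n+1) = (n+1/4)*(n+3/4) / ((n:ℝ)+1)^2 *
      (poch (1/2) (2*n) / poch 1 (2*n) * J (2*n)) := by rw [ih, hh]; ring
    rw [this, hJ]
    field_simp
    ring

lemma bcoef_bd (m : ℕ) : |poch (1/2) m / poch 1 m| ≤ 1 := by
  rw [abs_of_nonneg (div_nonneg (poch_pos' _ (by norm_num) m).le (poch_pos' _ one_pos m).le)]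
  rw [div_le_one (poch_pos' _ one_pos m)]
  induction m with
  | zero => simp [poch_zero']
  | succ n ih =>
    rw [poch_succ', poch_succ']
    have := poch_pos' 1 one_pos n
    gcongr
    norm_num

lemma F_integral : π * ps (hc (1/4) (3/4)) (1/9) = ∫ t in (0:ℝ)..π, 1/(1 - cos t/3)^(1/2:ℝ) := by
  have hcos : ∀ t : ℝ, |cos t / 3| ≤ 1/3 := by
    intro t
    rw [abs_div, abs_of_pos (by norm_num : (0:ℝ) < 3)]
    have := abs_cos_le_one t
    linarith
  have key : HasSum (fun m : ℕ => ∫ t in (0:ℝ)..π, poch (1/2) m / poch 1 m * (cos t / 3)^m)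
      (∫ t in (0:ℝ)..π, 1/(1 - cos t/3)^(1/2:ℝ)) := by
    refine intervalIntegral.hasSum_integral_of_dominated_convergence
      (fun m _ => (1/3:ℝ)^m) ?_ ?_ ?_ ?_ ?_
    · intro m
      exact (by fun_prop : Continuous fun t : ℝ =>
        poch (1/2) m / poch 1 m * (cos t / 3)^m).aestronglyMeasurable
    · intro m
      refine Filter.Eventually.of_forall fun t _ => ?_
      rw [Real.norm_eq_abs, abs_mul, abs_pow]
      calc _ ≤ 1 * (1/3:ℝ)^m := by
            gcongr
            · exact bcoef_bd m
            · exact hcos t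
        _ = _ := one_mul _
    · refine Filter.Eventually.of_forall fun t _ => ?_
      exact summable_geometric_of_lt_one (by norm_num) (by norm_num)
    · exact intervalIntegrable_const
    · refine Filter.Eventually.of_forall fun t _ => ?_
      exact bin_hasSum ((hcos t).trans_lt (by norm_num))
  have hterm : ∀ m : ℕ, ∫ t in (0:ℝ)..π, poch (1/2) m / poch 1 m * (cos t / 3)^m
      = (poch (1/2) m / poch 1 m * J m) * (1/3)^m := by
    intro m
    rw [intervalIntegral.integral_const_mul]
    unfold J
    simp_rw [div_pow]
    rw [intervalIntegral.integral_div]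
    rw [one_pow]; ring
  simp_rw [hterm] at key
  have hinj : Function.Injective (fun n : ℕ => 2*n) := fun a b h => by
    simpa using h
  rw [← hinj.hasSum_iff] at key
  · rw [← key.tsum_eq]
    unfold ps
    rw [← tsum_mul_left]
    refine tsum_congr fun n => ?_
    simp only [Function.comp_apply]
    rw [bJ_even, pow_mul]; norm_num; ring
  · intro m hm
    rcases Nat.even_or_odd' m with ⟨k, rfl | rfl⟩
    · exact absurd ⟨k, rfl⟩ hm
    · rw [J_odd]; simp

lemma beta_val : ∫ v in Set.Ioo (0:ℝ) 1, v^(-3/4:ℝ) * (1-v)^(-1/2:ℝ)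
    = Gamma (1/4) * √π / Gamma (3/4) := by
  have h := ProbabilityTheory.beta_eq_betaIntegralReal (1/4) (1/2) (by norm_num) (by norm_num)
  unfold ProbabilityTheory.beta at h
  rw [show (1/4+1/2:ℝ) = 3/4 by norm_num, Gamma_one_half_eq] at h
  rw [h, Complex.betaIntegral, intervalIntegral.integral_of_le zero_le_one,
    ← MeasureTheory.integral_Ioc_eq_integral_Ioo]
  rw [MeasureTheory.integral_Ioc_eq_integral_Ioo, MeasureTheory.integral_Ioc_eq_integral_Ioo]
  have : ∫ (x : ℝ) in Set.Ioo 0 1, (x:ℂ) ^ (((1/4:ℝ):ℂ) - 1) * (1 - (x:ℂ)) ^ (((1/2:ℝ):ℂ) - 1)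
      = ∫ (x : ℝ) in Set.Ioo 0 1, ((x^(-3/4:ℝ) * (1-x)^(-1/2:ℝ) : ℝ) : ℂ) := by
    refine MeasureTheory.setIntegral_congr_fun measurableSet_Ioo fun x hx => ?_
    rw [Complex.ofReal_mul, Complex.ofReal_cpow hx.1.le, Complex.ofReal_cpow (by linarith [hx.2])]
    push_cast
    norm_num
  rw [this, integral_complex_ofReal, Complex.ofReal_re]

lemma sub_val : ∫ v in Set.Ioo (0:ℝ) 1, v^(-3/4:ℝ) * (1-v)^(-1/2:ℝ)
    = √(2/3) * (2 * ∫ t in (0:ℝ)..π, 1/(1 - cos t/3)^(1/2:ℝ)) := by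
  have himg : (fun t : ℝ => sin (t/2)^4) '' Set.Ioo 0 π = Set.Ioo 0 1 := by
    ext v
    constructor
    · rintro ⟨t, ⟨h0, h1⟩, rfl⟩
      have s0 : 0 < sin (t/2) := sin_pos_of_pos_of_lt_pi (by linarith) (by linarith)
      have c0 : 0 < cos (t/2) := cos_pos_of_mem_Ioo ⟨by linarith, by linarith⟩
      have s1 : sin (t/2) < 1 := by nlinarith [sin_sq_add_cos_sq (t/2)]
      exact ⟨by positivity, pow_lt_one₀ s0.le s1 (by norm_num)⟩
    · rintro ⟨h0, h1⟩
      have hr0 : 0 < v^(1/4:ℝ) := rpow_pos_of_pos h0 _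
      have hr1 : v^(1/4:ℝ) < 1 := rpow_lt_one h0.le h1 (by norm_num)
      refine ⟨2 * arcsin (v^(1/4:ℝ)), ⟨?_, ?_⟩, ?_⟩
      · have := arcsin_pos.2 hr0; linarith
      · have := arcsin_lt_pi_div_two.2 hr1; linarith
      · simp only
        rw [mul_div_cancel_left₀ _ (two_ne_zero), sin_arcsin (by linarith) hr1.le,
          ← rpow_natCast, ← rpow_mul h0.le]
        norm_num
  have hinj : Set.InjOn (fun t : ℝ => sin (t/2)^4) (Set.Ioo 0 π) := by
    intro a ha b hb hab
    have sa : 0 < sin (a/2) := sin_pos_of_pos_of_lt_pi (by linarith [ha.1]) (by linarith [ha.2, pi_pos])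
    have sb : 0 < sin (b/2) := sin_pos_of_pos_of_lt_pi (by linarith [hb.1]) (by linarith [hb.2, pi_pos])
    have h := (pow_left_inj₀ sa.le sb.le (by norm_num : 4 ≠ 0)).1 hab
    have := injOn_sin ⟨by linarith [ha.1, pi_pos], by linarith [ha.2]⟩
      ⟨by linarith [hb.1, pi_pos], by linarith [hb.2]⟩ h
    linarith
  have hd : ∀ t ∈ Set.Ioo 0 π, HasDerivWithinAt (fun t : ℝ => sin (t/2)^4)
      (2 * sin (t/2)^3 * cos (t/2)) (Set.Ioo 0 π) t := by
    intro t _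
    have h1 : HasDerivAt (fun t : ℝ => t/2) (1/2) t := (hasDerivAt_id t).div_const 2
    have h2 := (h1.sin).pow 4
    refine (h2.congr_deriv ?_).hasDerivWithinAt
    simp; ring
  rw [← himg, MeasureTheory.integral_image_eq_integral_abs_deriv_smul measurableSet_Ioo hd hinj]
  rw [intervalIntegral.integral_of_le pi_pos.le, MeasureTheory.integral_Ioc_eq_integral_Ioo,
    ← MeasureTheory.integral_const_mul, ← MeasureTheory.integral_const_mul]
  refine MeasureTheory.setIntegral_congr_fun measurableSet_Ioo fun t ht => ?_
  obtain ⟨h0, h1⟩ := ht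
  have s0 : 0 < sin (t/2) := sin_pos_of_pos_of_lt_pi (by linarith) (by linarith)
  have c0 : 0 < cos (t/2) := cos_pos_of_mem_Ioo ⟨by linarith, by linarith⟩
  have hsc := sin_sq_add_cos_sq (t/2)
  have hct : cos t = 2 * cos (t/2)^2 - 1 := by rw [← cos_two_mul]; congr 1; ring
  simp only [smul_eq_mul]
  set s := sin (t/2)
  set c := cos (t/2)
  rw [abs_of_pos (by positivity)]
  have e1 : (s^4)^(-3/4:ℝ) = (s^3)⁻¹ := by
    rw [← rpow_natCast, ← rpow_mul s0.le, ← rpow_natCast, ← rpow_neg s0.le]; norm_num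
  have e2 : 1 - s^4 = c^2 * (1+s^2) := by
    linear_combination (-1 - s^2) * hsc
  have e3 : 1 - cos t / 3 = 2/3 * (1+s^2) := by
    rw [hct]; linear_combination (-2/3) * hsc
  have e4 : (c^2 * (1+s^2))^(-1/2:ℝ) = (c * √(1+s^2))⁻¹ := by
    rw [show (-1/2:ℝ) = -(1/2) by norm_num, rpow_neg (by positivity), ← sqrt_eq_rpow,
      sqrt_mul (by positivity), sqrt_sq c0.le]
  rw [e1, e2, e3, e4, ← sqrt_eq_rpow, sqrt_mul (by positivity)]
  have : 0 < √(1+s^2) := by positivity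
  have : 0 < √(2/3:ℝ) := by positivity
  field_simp

lemma F_val : ps (hc (1/4) (3/4)) (1/9) = √(3/2) / (2*π) * (Gamma (1/4) * √π / Gamma (3/4)) := by
  rw [← beta_val, sub_val, ← F_integral]
  have h : √(3/2:ℝ) * √(2/3) = 1 := by
    rw [← sqrt_mul (by norm_num)]; norm_num
  have := pi_pos
  field_simp
  linear_combination (-ps (hc (1/4) (3/4)) (1/9)) * h

theorem stmt_3 :
    ∑' n : ℕ, (poch (1/2) n * poch (1/4) n * poch (3/4) n) / (poch 1 n)^3 * ((1:ℝ)) * ((32:ℝ)/81)^n = Real.sqrt 3 * π / (2 * (Real.Gamma (7/12))^2 * (Real.Gamma (11/12))^2) := by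
  rw [series_eq_sq, F_val]
  have h4 := gamma_quarter
  have hp : 0 < Gamma (3/4) := Gamma_pos_of_pos (by norm_num)
  have hq : Gamma (1/4) = π * √2 / Gamma (3/4) := by
    rw [eq_div_iff hp.ne', h4]
  have hg := gamma_twelfths
  rw [show 2 * (Real.Gamma (7/12))^2 * (Real.Gamma (11/12))^2
    = 2 * ((Real.Gamma (7/12))^2 * (Real.Gamma (11/12))^2) by ring, hg, hq]
  have hpi := pi_pos
  have a1 : √(3/2:ℝ)^2 = 3/2 := sq_sqrt (by norm_num)
  have a2 : √2^2 = (2:ℝ) := sq_sqrt (by norm_num)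
  have a3 : √3^2 = (3:ℝ) := sq_sqrt (by norm_num)
  have a4 : √π^2 = π := sq_sqrt hpi.le
  have a5 : (0:ℝ) < √3 := by positivity
  simp only [mul_pow, div_pow, a1, a2, a4]
  field_simp
  rw [a3]
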